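/- Let E be a real inner product space, let e, d ∈ E, let r, β ∈ ℝ, and set A = 2r - 1. Then the DiffusionNFT branch loss satisfies the exact algebraic identity r·‖e + β·d‖² + (1 - r)·‖e - β·d‖² = β·( A·‖e + d‖² + (β - A)·‖d‖² ) + (1 - β·A)·‖e‖². In particular, the branch loss equals β·A·‖e + d‖² + β·(β - A)·‖d‖² up to the additive term (1 - β·A)·‖e‖², which is independent of the trainable model. -/

import Mathlib

/-- Exact algebraic identity for the DiffusionNFT branch loss: with `A = 2r - 1`,
`r·‖e + β·d‖² + (1 - r)·‖e - β·d‖²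
  = β·(A·‖e + d‖² + (β - A)·‖d‖²) + (1 - β·A)·‖e‖²`. -/
theorem diffusionNFT_branch_loss_identity
    {E : Type*} [NormedAddCommGroup E] [InnerProductSpace ℝ E]
    (e d : E) (r β A : ℝ) (hA : A = 2 * r - 1) :
    r * ‖e + β • d‖ ^ 2 + (1 - r) * ‖e - β • d‖ ^ 2
      = β * (A * ‖e + d‖ ^ 2 + (β - A) * ‖d‖ ^ 2) + (1 - β * A) * ‖e‖ ^ 2 := by
  subst hA
  rw [norm_add_sq_real, norm_sub_sq_real, norm_add_sq_real, real_inner_smul_right, norm_smul,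
    mul_pow, Real.norm_eq_abs, sq_abs]
  ring
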